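/- Under the adapted cuspidal-edge setting, the Gaussian curvature K_{ŴFC} of the focal surface ŴFC_f = f + (λ/κ̂)ν satisfies, at every point (u₀,0) of the u-axis, K_{ŴFC}(u₀,0) = −(1/4)·(4κ_t(u₀)² + κ_s(u₀)κ_c(u₀)²). -/

import Mathlib

noncomputable section

local notation "⟪" x ", " y "⟫" => @inner ℝ _ _ x y

/-- Euclidean 3-space. -/
abbrev E3 : Type := EuclideanSpace ℝ (Fin 3)

/-- The vector in `E3` with coordinates `(a, b, c)`. -/
def e3 (a b c : ℝ) : E3 := (WithLp.equiv 2 (Fin 3 → ℝ)).symm ![a, b, c]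

/-- Cross product on `E3`. -/
def cross3 (a b : E3) : E3 :=
  e3 (a 1 * b 2 - a 2 * b 1) (a 2 * b 0 - a 0 * b 2) (a 0 * b 1 - a 1 * b 0)

/-- Scalar triple product `det(a,b,c)`. -/
def det3 (a b c : E3) : ℝ := ⟪a, cross3 b c⟫

/-- Partial derivative in the `u`-direction. -/
def pu {E : Type*} [NormedAddCommGroup E] [NormedSpace ℝ E] (g : ℝ × ℝ → E) (p : ℝ × ℝ) : E :=
  fderiv ℝ g p (1, 0)

/-- Partial derivative in the `v`-direction. -/
def pv {E : Type*} [NormedAddCommGroup E] [NormedSpace ℝ E] (g : ℝ × ℝ → E) (p : ℝ × ℝ) : E :=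
  fderiv ℝ g p (0, 1)

/-- Signed area density `λ = det(f_u, f_v, ν)`. -/
def lam (f ν : ℝ × ℝ → E3) (p : ℝ × ℝ) : ℝ := det3 (pu f p) (pv f p) (ν p)


/-- `Ẽ = |f_u|²`. -/
def Etil (f : ℝ × ℝ → E3) (p : ℝ × ℝ) : ℝ := ‖pu f p‖ ^ 2

/-- `F̃ = ⟨f_u, h⟩`. -/
def Ftil (f h : ℝ × ℝ → E3) (p : ℝ × ℝ) : ℝ := ⟪pu f p, h p⟫

/-- `G̃ = |h|²`. -/
def Gtil (h : ℝ × ℝ → E3) (p : ℝ × ℝ) : ℝ := ‖h p‖ ^ 2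

/-- `L̃ = −⟨f_u, ν_u⟩`. -/
def Ltil (f ν : ℝ × ℝ → E3) (p : ℝ × ℝ) : ℝ := -⟪pu f p, pu ν p⟫

/-- `M̃ = −⟨h, ν_u⟩`. -/
def Mtil (ν h : ℝ × ℝ → E3) (p : ℝ × ℝ) : ℝ := -⟪h p, pu ν p⟫

/-- `Ñ = −⟨h, ν_v⟩`. -/
def Ntil (ν h : ℝ × ℝ → E3) (p : ℝ × ℝ) : ℝ := -⟪h p, pv ν p⟫

/-- `Ã = ẼÑ − 2vF̃M̃ + vG̃L̃`. -/
def Atil (f ν h : ℝ × ℝ → E3) (p : ℝ × ℝ) : ℝ :=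
  Etil f p * Ntil ν h p - 2 * p.2 * Ftil f h p * Mtil ν h p + p.2 * Gtil h p * Ltil f ν p

/-- `B̃ = √(Ã² − 4v(ẼG̃−F̃²)(L̃Ñ−vM̃²))`. -/
def Btil (f ν h : ℝ × ℝ → E3) (p : ℝ × ℝ) : ℝ :=
  Real.sqrt ((Atil f ν h p) ^ 2 -
    4 * p.2 * (Etil f p * Gtil h p - (Ftil f h p) ^ 2) *
      (Ltil f ν p * Ntil ν h p - p.2 * (Mtil ν h p) ^ 2))

/-- The bounded principal curvature `κ = 2(L̃Ñ−vM̃²)/(Ã+B̃)`. -/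
def kap (f ν h : ℝ × ℝ → E3) (p : ℝ × ℝ) : ℝ :=
  2 * (Ltil f ν p * Ntil ν h p - p.2 * (Mtil ν h p) ^ 2) / (Atil f ν h p + Btil f ν h p)

/-- `κ̂ = (Ã+B̃)/(2|f_u×h|)`, the smooth extension of `λ·κ₁`. -/
def kaphat (f ν h : ℝ × ℝ → E3) (p : ℝ × ℝ) : ℝ :=
  (Atil f ν h p + Btil f ν h p) / (2 * ‖cross3 (pu f p) (h p)‖)

/-- Singular curvature `κ_s` along the u-axis. -/
def kappas (f ν : ℝ × ℝ → E3) (u : ℝ) : ℝ :=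
  det3 (pu f (u, 0)) (pu (pu f) (u, 0)) (ν (u, 0)) / ‖pu f (u, 0)‖ ^ 3

/-- Cuspidal curvature `κ_c` along the u-axis. -/
def kappac (f ν h : ℝ × ℝ → E3) (u : ℝ) : ℝ :=
  2 * Etil f (u, 0) ^ ((3 : ℝ) / 4) * Ntil ν h (u, 0) /
    (Etil f (u, 0) * Gtil h (u, 0) - (Ftil f h (u, 0)) ^ 2) ^ ((3 : ℝ) / 4)

/-- Cusp-directional torsion `κ_t` along the u-axis. -/
def kappat (f ν h : ℝ × ℝ → E3) (u : ℝ) : ℝ :=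
  (Etil f (u, 0) * Mtil ν h (u, 0) - Ftil f h (u, 0) * Ltil f ν (u, 0)) /
    (Etil f (u, 0) * Real.sqrt (Etil f (u, 0) * Gtil h (u, 0) - (Ftil f h (u, 0)) ^ 2))

/-- The focal surface `ŴFC_f = f + (λ/κ̂)ν`. -/
def FChat (f ν h : ℝ × ℝ → E3) (p : ℝ × ℝ) : E3 :=
  f p + (lam f ν p / kaphat f ν h p) • ν p

/-- Coefficient `E` of the first fundamental form of a surface `W`. -/
def surfE (W : ℝ × ℝ → E3) (p : ℝ × ℝ) : ℝ := ‖pu W p‖ ^ 2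

/-- Coefficient `F` of the first fundamental form of a surface `W`. -/
def surfF (W : ℝ × ℝ → E3) (p : ℝ × ℝ) : ℝ := ⟪pu W p, pv W p⟫

/-- Coefficient `G` of the first fundamental form of a surface `W`. -/
def surfG (W : ℝ × ℝ → E3) (p : ℝ × ℝ) : ℝ := ‖pv W p‖ ^ 2

/-- Unit normal `n = (W_u × W_v)/|W_u × W_v|` of a surface `W`. -/
def surfn (W : ℝ × ℝ → E3) (p : ℝ × ℝ) : E3 :=
  ‖cross3 (pu W p) (pv W p)‖⁻¹ • cross3 (pu W p) (pv W p)

/-- Coefficient `L = ⟨W_uu, n⟩` of the second fundamental form. -/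
def surfL (W : ℝ × ℝ → E3) (p : ℝ × ℝ) : ℝ := ⟪pu (pu W) p, surfn W p⟫

/-- Coefficient `M = ⟨W_uv, n⟩` of the second fundamental form. -/
def surfM (W : ℝ × ℝ → E3) (p : ℝ × ℝ) : ℝ := ⟪pv (pu W) p, surfn W p⟫

/-- Coefficient `N = ⟨W_vv, n⟩` of the second fundamental form. -/
def surfN (W : ℝ × ℝ → E3) (p : ℝ × ℝ) : ℝ := ⟪pv (pv W) p, surfn W p⟫

/-- Gaussian curvature of a surface `W`. -/
def gaussK (W : ℝ × ℝ → E3) (p : ℝ × ℝ) : ℝ :=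
  (surfL W p * surfN W p - (surfM W p) ^ 2) /
    (surfE W p * surfG W p - (surfF W p) ^ 2)

/-- Mean curvature of a surface `W` (w.r.t. the unit normal `surfn W`). -/
def meanH (W : ℝ × ℝ → E3) (p : ℝ × ℝ) : ℝ :=
  (surfE W p * surfN W p - 2 * surfF W p * surfM W p + surfG W p * surfL W p) /
    (2 * (surfE W p * surfG W p - (surfF W p) ^ 2))

theorem inner_e3_coord (x y : E3) :
    (⟪x, y⟫ : ℝ) = x 0 * y 0 + x 1 * y 1 + x 2 * y 2 := by
  simp only [PiLp.inner_apply, RCLike.inner_apply, conj_trivial, Fin.sum_univ_three]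
  ring

@[simp] theorem e3_apply_zero (a b c : ℝ) : e3 a b c 0 = a := rfl

@[simp] theorem e3_apply_one (a b c : ℝ) : e3 a b c 1 = b := rfl

@[simp] theorem e3_apply_two (a b c : ℝ) : e3 a b c 2 = c := rfl

theorem cross3_smul_right (r : ℝ) (a b : E3) : cross3 a (r • b) = r • cross3 a b := by
  ext i
  fin_cases i <;> simp [cross3] <;> ring

theorem norm_cross3_sq (a b : E3) :
    ‖cross3 a b‖ ^ 2 = ‖a‖ ^ 2 * ‖b‖ ^ 2 - (⟪a, b⟫ : ℝ) ^ 2 := by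
  simp only [← real_inner_self_eq_norm_sq, inner_e3_coord, cross3, e3_apply_zero, e3_apply_one,
    e3_apply_two]
  ring

theorem inner_right_cross3 (a b : E3) : (⟪b, cross3 a b⟫ : ℝ) = 0 := by
  simp only [inner_e3_coord, cross3, e3_apply_zero, e3_apply_one, e3_apply_two]
  ring

theorem det3_smul_middle (r : ℝ) (a b c : E3) : det3 a (r • b) c = r * det3 a b c := by
  simp only [det3, inner_e3_coord, cross3, e3_apply_zero, e3_apply_one, e3_apply_two,
    PiLp.smul_apply, smul_eq_mul]
  ring

theorem det3_eq_inner_cross3 (a b c : E3) : det3 a b c = ⟪cross3 a b, c⟫ := by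
  simp only [det3, inner_e3_coord, cross3, e3_apply_zero, e3_apply_one, e3_apply_two]
  ring

theorem inner_cross3_eq_neg_det3 (x a c : E3) : (⟪x, cross3 a c⟫ : ℝ) = -det3 a x c := by
  simp only [det3, inner_e3_coord, cross3, e3_apply_zero, e3_apply_one, e3_apply_two]
  ring

/-- The Parseval identity in the orthogonal frame `(a, a × n, n)`, where `n` is a unit vector
orthogonal to `a`. -/
theorem inner_eq_of_frame {a n : E3} (hn : ‖n‖ = 1) (han : (⟪a, n⟫ : ℝ) = 0) (x y : E3) :
    ‖a‖ ^ 2 * (⟪x, y⟫ : ℝ) = ⟪a, x⟫ * ⟪a, y⟫ + ⟪x, cross3 a n⟫ * ⟪y, cross3 a n⟫ +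
      ‖a‖ ^ 2 * (⟪n, x⟫ * ⟪n, y⟫) := by
  have gram : (⟪x, cross3 a n⟫ : ℝ) * ⟪y, cross3 a n⟫ =
      ⟪x, y⟫ * (⟪a, a⟫ * ⟪n, n⟫ - ⟪a, n⟫ * ⟪a, n⟫) -
      ⟪a, y⟫ * (⟪a, x⟫ * ⟪n, n⟫ - ⟪a, n⟫ * ⟪n, x⟫) +
      ⟪n, y⟫ * (⟪a, x⟫ * ⟪a, n⟫ - ⟪a, a⟫ * ⟪n, x⟫) := by
    simp only [inner_e3_coord, cross3, e3_apply_zero, e3_apply_one, e3_apply_two]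
    ring
  rw [gram, han, real_inner_self_eq_norm_sq, real_inner_self_eq_norm_sq, hn]
  ring

theorem ContDiffAt.pu {E : Type*} [NormedAddCommGroup E] [NormedSpace ℝ E] {m n : WithTop ℕ∞}
    {g : ℝ × ℝ → E} {p : ℝ × ℝ} (hg : ContDiffAt ℝ n g p) (hmn : m + 1 ≤ n) :
    ContDiffAt ℝ m (pu g) p :=
  (hg.fderiv_right hmn).clm_apply contDiffAt_const

theorem ContDiffAt.pv {E : Type*} [NormedAddCommGroup E] [NormedSpace ℝ E] {m n : WithTop ℕ∞}
    {g : ℝ × ℝ → E} {p : ℝ × ℝ} (hg : ContDiffAt ℝ n g p) (hmn : m + 1 ≤ n) :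
    ContDiffAt ℝ m (pv g) p :=
  (hg.fderiv_right hmn).clm_apply contDiffAt_const

theorem contDiffAt_cross3 {n : WithTop ℕ∞} {a b : ℝ × ℝ → E3} {p : ℝ × ℝ}
    (ha : ContDiffAt ℝ n a p) (hb : ContDiffAt ℝ n b p) :
    ContDiffAt ℝ n (fun q => cross3 (a q) (b q)) p := by
  have ha' := contDiffAt_euclidean.1 ha
  have hb' := contDiffAt_euclidean.1 hb
  refine contDiffAt_euclidean.2 fun i => ?_
  fin_cases i
  · exact ((ha' 1).mul (hb' 2)).sub ((ha' 2).mul (hb' 1))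
  · exact ((ha' 2).mul (hb' 0)).sub ((ha' 0).mul (hb' 2))
  · exact ((ha' 0).mul (hb' 1)).sub ((ha' 1).mul (hb' 0))

section PartialDerivatives

variable {E : Type*} [NormedAddCommGroup E] [NormedSpace ℝ E] {g k : ℝ × ℝ → E} {p : ℝ × ℝ}

theorem Filter.EventuallyEq.pu_eq (hgk : g =ᶠ[nhds p] k) : pu g p = pu k p := by
  rw [pu, pu, hgk.fderiv_eq]

theorem Filter.EventuallyEq.pv_eq (hgk : g =ᶠ[nhds p] k) : pv g p = pv k p := by
  rw [pv, pv, hgk.fderiv_eq]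

theorem pu_add (hg : DifferentiableAt ℝ g p) (hk : DifferentiableAt ℝ k p) :
    pu (fun q => g q + k q) p = pu g p + pu k p := by
  simp only [pu, fderiv_fun_add hg hk, add_apply]

theorem pv_add (hg : DifferentiableAt ℝ g p) (hk : DifferentiableAt ℝ k p) :
    pv (fun q => g q + k q) p = pv g p + pv k p := by
  simp only [pv, fderiv_fun_add hg hk, add_apply]

theorem pu_smul {r : ℝ × ℝ → ℝ} (hr : DifferentiableAt ℝ r p) (hk : DifferentiableAt ℝ k p) :
    pu (fun q => r q • k q) p = r p • pu k p + pu r p • k p := by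
  simp [pu, fderiv_fun_smul hr hk]

theorem pv_smul {r : ℝ × ℝ → ℝ} (hr : DifferentiableAt ℝ r p) (hk : DifferentiableAt ℝ k p) :
    pv (fun q => r q • k q) p = r p • pv k p + pv r p • k p := by
  simp [pv, fderiv_fun_smul hr hk]

theorem pu_snd_smul (hk : DifferentiableAt ℝ k p) :
    pu (fun q => q.2 • k q) p = p.2 • pu k p := by
  rw [pu_smul differentiableAt_snd hk]
  simp [pu, fderiv_snd]

theorem pv_snd_smul (hk : DifferentiableAt ℝ k p) :
    pv (fun q => q.2 • k q) p = p.2 • pv k p + k p := by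
  rw [pv_smul differentiableAt_snd hk]
  simp [pv, fderiv_snd]

theorem pv_pu_eq_pu_pv (hg : ContDiffAt ℝ 2 g p) : pv (pu g) p = pu (pv g) p := by
  have hd : DifferentiableAt ℝ (fderiv ℝ g) p :=
    (hg.fderiv_right (m := 1) (by norm_num)).differentiableAt (by norm_num)
  have hs : IsSymmSndFDerivAt ℝ g p := hg.isSymmSndFDerivAt (by simp)
  have e1 : pv (pu g) p = fderiv ℝ (fderiv ℝ g) p (0, 1) (1, 0) := by
    have := fderiv_clm_apply hd (differentiableAt_const ((1 : ℝ), (0 : ℝ)))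
    simp only [pv]
    change fderiv ℝ (fun q => fderiv ℝ g q (1, 0)) p (0, 1) = _
    rw [this]
    simp
  have e2 : pu (pv g) p = fderiv ℝ (fderiv ℝ g) p (1, 0) (0, 1) := by
    have := fderiv_clm_apply hd (differentiableAt_const ((0 : ℝ), (1 : ℝ)))
    simp only [pu]
    change fderiv ℝ (fun q => fderiv ℝ g q (0, 1)) p (1, 0) = _
    rw [this]
    simp
  rw [e1, e2, hs]

theorem pv_pu_eq_zero (hp : p.2 = 0) (hg : ContDiffAt ℝ 2 g p) (hk : DifferentiableAt ℝ k p)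
    (hgv : ∀ᶠ q in nhds p, pv g q = q.2 • k q) : pv (pu g) p = 0 := by
  rw [pv_pu_eq_pu_pv hg, Filter.EventuallyEq.pu_eq (k := fun q => q.2 • k q) hgv,
    pu_snd_smul hk, hp, zero_smul]

end PartialDerivatives

/-- The partial derivatives up to order two, on the `u`-axis, of a surface `W` that is locally
`f + v g`, where `f_v = v h`. -/
theorem partials_of_eq_add_snd_smul {W f g h : ℝ × ℝ → E3} {p : ℝ × ℝ} (hp : p.2 = 0)
    (hf : ContDiffAt ℝ 2 f p) (hg : ContDiffAt ℝ 2 g p) (hh : DifferentiableAt ℝ h p)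
    (hfv : ∀ᶠ q in nhds p, pv f q = q.2 • h q)
    (hW : W =ᶠ[nhds p] fun q => f q + q.2 • g q) :
    pu W p = pu f p ∧ pv W p = g p ∧ pu (pu W) p = pu (pu f) p ∧ pv (pu W) p = pu g p ∧
      pv (pv W) p = h p + (2 : ℝ) • pv g p := by
  have hdf : ∀ᶠ q in nhds p, DifferentiableAt ℝ f q :=
    (hf.eventually (by simp)).mono fun q hq => hq.differentiableAt (by norm_num)
  have hdg : ∀ᶠ q in nhds p, DifferentiableAt ℝ g q :=
    (hg.eventually (by simp)).mono fun q hq => hq.differentiableAt (by norm_num)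
  have hfu : DifferentiableAt ℝ (pu f) p :=
    (hf.pu (m := 1) (by norm_num)).differentiableAt (by norm_num)
  have hgu : DifferentiableAt ℝ (pu g) p :=
    (hg.pu (m := 1) (by norm_num)).differentiableAt (by norm_num)
  have hgv : DifferentiableAt ℝ (pv g) p :=
    (hg.pv (m := 1) (by norm_num)).differentiableAt (by norm_num)
  have hu : pu W =ᶠ[nhds p] fun q => pu f q + q.2 • pu g q := by
    filter_upwards [hW.eventuallyEq_nhds, hdf, hdg] with q h1 h2 h3
    rw [h1.pu_eq, pu_add h2 (differentiableAt_snd.fun_smul h3), pu_snd_smul h3]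
  have hv : pv W =ᶠ[nhds p] fun q => g q + q.2 • (h q + pv g q) := by
    filter_upwards [hW.eventuallyEq_nhds, hdf, hdg, hfv] with q h1 h2 h3 h4
    rw [h1.pv_eq, pv_add h2 (differentiableAt_snd.fun_smul h3), pv_snd_smul h3, h4, smul_add]
    abel
  have hfuv := pv_pu_eq_zero hp hf hh hfv
  refine ⟨?_, ?_, ?_, ?_, ?_⟩
  · simpa [hp] using hu.eq_of_nhds
  · simpa [hp] using hv.eq_of_nhds
  · rw [hu.pu_eq, pu_add hfu (differentiableAt_snd.fun_smul hgu), pu_snd_smul hgu, hp]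
    simp
  · rw [hu.pv_eq, pv_add hfu (differentiableAt_snd.fun_smul hgu), pv_snd_smul hgu, hp, hfuv]
    simp
  · rw [hv.pv_eq, pv_add hdg.self_of_nhds (differentiableAt_snd.fun_smul (hh.fun_add hgv)),
      pv_snd_smul (hh.fun_add hgv), hp, two_smul]
    simp only [zero_smul, zero_add]
    abel

theorem contDiffAt_kaphat {f ν h : ℝ × ℝ → E3} {p : ℝ × ℝ} (hp : p.2 = 0)
    (hf : ContDiffAt ℝ (⊤ : ℕ∞) f p) (hν : ContDiffAt ℝ (⊤ : ℕ∞) ν p)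
    (hh : ContDiffAt ℝ (⊤ : ℕ∞) h p) (hX : cross3 (pu f p) (h p) ≠ 0)
    (hA : Atil f ν h p ≠ 0) : ContDiffAt ℝ (⊤ : ℕ∞) (kaphat f ν h) p := by
  have hfu : ContDiffAt ℝ (⊤ : ℕ∞) (pu f) p := hf.pu (by simp)
  have hνu : ContDiffAt ℝ (⊤ : ℕ∞) (pu ν) p := hν.pu (by simp)
  have hνv : ContDiffAt ℝ (⊤ : ℕ∞) (pv ν) p := hν.pv (by simp)
  have hE : ContDiffAt ℝ (⊤ : ℕ∞) (Etil f) p := hfu.norm_sq ℝ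
  have hF : ContDiffAt ℝ (⊤ : ℕ∞) (Ftil f h) p := hfu.inner ℝ hh
  have hG : ContDiffAt ℝ (⊤ : ℕ∞) (Gtil h) p := hh.norm_sq ℝ
  have hL : ContDiffAt ℝ (⊤ : ℕ∞) (Ltil f ν) p := (hfu.inner ℝ hνu).neg
  have hM : ContDiffAt ℝ (⊤ : ℕ∞) (Mtil ν h) p := (hh.inner ℝ hνu).neg
  have hN : ContDiffAt ℝ (⊤ : ℕ∞) (Ntil ν h) p := (hh.inner ℝ hνv).neg
  have h2 : ContDiffAt ℝ (⊤ : ℕ∞) (fun q : ℝ × ℝ => q.2) p := contDiffAt_snd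
  have hAs : ContDiffAt ℝ (⊤ : ℕ∞) (Atil f ν h) p :=
    ((hE.mul hN).sub (((contDiffAt_const.mul h2).mul hF).mul hM)).add ((h2.mul hG).mul hL)
  have hBs : ContDiffAt ℝ (⊤ : ℕ∞) (Btil f ν h) p := by
    refine ContDiffAt.sqrt ((hAs.pow 2).sub (((contDiffAt_const.mul h2).mul
      ((hE.mul hG).sub (hF.pow 2))).mul ((hL.mul hN).sub (h2.mul (hM.pow 2))))) ?_
    simp only [hp]
    simpa using hA
  exact (hAs.add hBs).div (contDiffAt_const.mul ((contDiffAt_cross3 hfu hh).norm ℝ hX))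
    (mul_ne_zero two_ne_zero (norm_ne_zero_iff.2 hX))

theorem sq_rpow_three_quarters_sq {x : ℝ} (hx : 0 ≤ x) : ((x ^ 2) ^ ((3 : ℝ) / 4)) ^ 2 = x ^ 3 := by
  rw [← Real.rpow_natCast x 2, ← Real.rpow_mul hx, ← Real.rpow_natCast, ← Real.rpow_mul hx,
    ← Real.rpow_natCast x 3]
  norm_num

/-- along the u-axis, the Gaussian curvature of the focal surface `ŴFC_f`
is `K = −(1/4)(4κ_t² + κ_sκ_c²)`. -/
theorem stmt12
    (U : Set (ℝ × ℝ)) (hU : IsOpen U)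
    (f ν h : ℝ × ℝ → E3)
    (hf : ContDiffOn ℝ (⊤ : ℕ∞) f U) (hν : ContDiffOn ℝ (⊤ : ℕ∞) ν U) (hhsm : ContDiffOn ℝ (⊤ : ℕ∞) h U)
    (hax : ∃ p ∈ U, p.2 = (0 : ℝ))
    (hν1 : ∀ p ∈ U, ‖ν p‖ = 1)
    (ho1 : ∀ p ∈ U, (⟪pu f p, ν p⟫ : ℝ) = 0)
    (ho2 : ∀ p ∈ U, (⟪pv f p, ν p⟫ : ℝ) = 0)
    (hfront : ∀ p ∈ U, Function.Injective ⇑(fderiv ℝ (fun q => (f q, ν q)) p))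
    (hlam : ∀ p ∈ U, (lam f ν p = 0 ↔ p.2 = 0))
    (hh0 : ∀ p ∈ U, h p ≠ 0)
    (hfv : ∀ p ∈ U, pv f p = p.2 • h p)
    (hνdef : ∀ p ∈ U, ν p = ‖cross3 (pu f p) (h p)‖⁻¹ • cross3 (pu f p) (h p))
    (hNpos : ∀ p ∈ U, p.2 = 0 → 0 < Ntil ν h p)
    (u₀ : ℝ) (hp : ((u₀, 0) : ℝ × ℝ) ∈ U) :
    gaussK (FChat f ν h) (u₀, 0) =
      -(1 / 4) * (4 * (kappat f ν h u₀) ^ 2 + kappas f ν u₀ * (kappac f ν h u₀) ^ 2) := by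
  obtain ⟨p, hpdef⟩ : ∃ p : ℝ × ℝ, p = (u₀, 0) := ⟨_, rfl⟩
  have hp2 : p.2 = 0 := by rw [hpdef]
  simp only [kappat, kappas, kappac]
  rw [← hpdef] at hp ⊢
  have hUp : U ∈ nhds p := hU.mem_nhds hp
  have cf := hf.contDiffAt hUp
  have cν := hν.contDiffAt hUp
  have ch := hhsm.contDiffAt hUp
  have hfu : ContDiffAt ℝ (⊤ : ℕ∞) (pu f) p := cf.pu (by simp)
  have dν : DifferentiableAt ℝ ν p := cν.differentiableAt (by simp)
  have dh : DifferentiableAt ℝ h p := ch.differentiableAt (by simp)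
  have hX : cross3 (pu f p) (h p) ≠ 0 := by
    intro h0
    have h1 := hν1 p hp
    rw [hνdef p hp, h0] at h1
    simp at h1
  have ha : pu f p ≠ 0 := by
    intro h0
    apply hX
    ext i
    fin_cases i <;> simp [cross3, h0]
  obtain ⟨e, he⟩ : ∃ e : ℝ, e = ‖pu f p‖ := ⟨_, rfl⟩
  obtain ⟨s, hs⟩ : ∃ s : ℝ, s = ‖cross3 (pu f p) (h p)‖ := ⟨_, rfl⟩
  have he0 : 0 < e := he ▸ norm_pos_iff.2 ha
  have hs0 : 0 < s := hs ▸ norm_pos_iff.2 hX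
  have hN0 := hNpos p hp hp2
  have hE : Etil f p = e ^ 2 := by rw [Etil, he]
  have hD : Etil f p * Gtil h p - Ftil f h p ^ 2 = s ^ 2 := by
    rw [hs, norm_cross3_sq]; rfl
  have hA : Atil f ν h p = e ^ 2 * Ntil ν h p := by simp [Atil, hp2, hE]
  have hA0 : 0 < Atil f ν h p := by rw [hA]; positivity
  have hB : Btil f ν h p = Atil f ν h p := by
    simp only [Btil, hp2]
    simpa using Real.sqrt_sq hA0.le
  have hκ : kaphat f ν h p = e ^ 2 * Ntil ν h p / s := by
    rw [kaphat, hB, hA, ← hs]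
    field_simp
    ring
  have hκ0 : kaphat f ν h p ≠ 0 := by rw [hκ]; positivity
  have cκ := contDiffAt_kaphat hp2 cf cν ch hX hA0.ne'
  obtain ⟨r, hr⟩ : ∃ r : ℝ × ℝ → ℝ,
      r = fun q => det3 (pu f q) (h q) (ν q) / kaphat f ν h q := ⟨_, rfl⟩
  have cr : ContDiffAt ℝ (⊤ : ℕ∞) r p := by
    rw [hr]
    exact (hfu.inner ℝ (contDiffAt_cross3 ch cν)).div cκ hκ0
  have dr : DifferentiableAt ℝ r p := cr.differentiableAt (by simp)
  have hdet : det3 (pu f p) (h p) (ν p) = s := by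
    rw [det3_eq_inner_cross3, hνdef p hp, real_inner_smul_right, real_inner_self_eq_norm_sq, ← hs]
    field_simp
  have hrp : r p = s ^ 2 / (e ^ 2 * Ntil ν h p) := by
    simp only [hr, hdet, hκ]
    field_simp
  have hr0 : 0 < r p := by rw [hrp]; positivity
  have hfvev : ∀ᶠ q in nhds p, pv f q = q.2 • h q := Filter.eventually_of_mem hUp hfv
  have hW : FChat f ν h =ᶠ[nhds p] fun q => f q + q.2 • (r q • ν q) := by
    filter_upwards [hUp] with q hq
    rw [FChat, lam, hfv q hq, det3_smul_middle, hr, mul_div_assoc, mul_smul]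
  have h2top : (2 : WithTop ℕ∞) ≤ ((⊤ : ℕ∞) : WithTop ℕ∞) :=
    WithTop.coe_le_coe.2 (le_top : (2 : ℕ∞) ≤ ⊤)
  obtain ⟨wu, wv, wuu, wuv, wvv⟩ := partials_of_eq_add_snd_smul
    (g := fun q => r q • ν q) hp2 (cf.of_le h2top) ((cr.smul cν).of_le h2top) dh hfvev hW
  rw [pu_smul dr dν] at wuv
  rw [pv_smul dr dν] at wvv
  have hfuv := pv_pu_eq_zero hp2 (cf.of_le h2top) dh hfvev
  have haνv : (⟪pu f p, pv ν p⟫ : ℝ) = 0 := by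
    have h1 : (fun q => (⟪pu f q, ν q⟫ : ℝ)) =ᶠ[nhds p] fun _ => 0 :=
      Filter.eventually_of_mem hUp ho1
    have h2 := h1.pv_eq
    have h3 := fderiv_inner_apply ℝ (hfu.differentiableAt (by simp)) dν (0, 1)
    rw [pv, h3] at h2
    change (⟪pu f p, pv ν p⟫ : ℝ) + ⟪pv (pu f) p, ν p⟫ = _ at h2
    rw [hfuv, inner_zero_left, add_zero] at h2
    simpa [pv] using h2
  have hνh : (⟪ν p, h p⟫ : ℝ) = 0 := by
    rw [hνdef p hp, real_inner_smul_left, real_inner_comm, inner_right_cross3, mul_zero]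
  obtain ⟨m, hm⟩ : ∃ m : E3, m = cross3 (pu f p) (ν p) := ⟨_, rfl⟩
  have hmnorm : ‖m‖ = e := by
    have h1 := norm_cross3_sq (pu f p) (ν p)
    rw [ho1 p hp, hν1 p hp, ← hm, ← he] at h1
    have h2 : ‖m‖ ^ 2 = e ^ 2 := by rw [h1]; ring
    exact (pow_left_inj₀ (norm_nonneg _) he0.le two_ne_zero).1 h2
  have hmh : (⟪h p, m⟫ : ℝ) = -s := by rw [hm, inner_cross3_eq_neg_det3, hdet]
  have hmν : (⟪ν p, m⟫ : ℝ) = 0 := by rw [hm, inner_right_cross3]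
  have hmνv : (⟪pv ν p, m⟫ : ℝ) = e ^ 2 * Ntil ν h p / s := by
    have h1 := inner_eq_of_frame (hν1 p hp) (ho1 p hp) (h p) (pv ν p)
    rw [haνv, hνh, ← hm, hmh, ← he] at h1
    rw [eq_div_iff hs0.ne', Ntil]
    linarith
  have hmνu : (⟪pu ν p, m⟫ : ℝ) = (e ^ 2 * Mtil ν h p - Ftil f h p * Ltil f ν p) / s := by
    have h1 := inner_eq_of_frame (hν1 p hp) (ho1 p hp) (h p) (pu ν p)
    rw [hνh, ← hm, hmh, ← he] at h1
    rw [eq_div_iff hs0.ne', Mtil, Ltil, Ftil]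
    linarith
  have hn : surfn (FChat f ν h) p = e⁻¹ • m := by
    rw [surfn, wu, wv, cross3_smul_right, ← hm, norm_smul, hmnorm, Real.norm_of_nonneg hr0.le,
      smul_smul]
    congr 1
    field_simp
  have hL' : surfL (FChat f ν h) p = -det3 (pu f p) (pu (pu f) p) (ν p) / e := by
    rw [surfL, wuu, hn, real_inner_smul_right, hm, inner_cross3_eq_neg_det3]
    field_simp
  have hM' : surfM (FChat f ν h) p =
      r p * ((e ^ 2 * Mtil ν h p - Ftil f h p * Ltil f ν p) / s) / e := by
    rw [surfM, wuv, hn, real_inner_smul_right, inner_add_left, real_inner_smul_left,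
      real_inner_smul_left, hmν, hmνu]
    field_simp
    ring
  have hN' : surfN (FChat f ν h) p = s / e := by
    rw [surfN, wvv, hn, real_inner_smul_right, inner_add_left, real_inner_smul_left,
      inner_add_left, real_inner_smul_left, real_inner_smul_left, hmν, hmνv, hmh, hrp]
    field_simp
    ring
  have hE' : surfE (FChat f ν h) p = e ^ 2 := by rw [surfE, wu, he]
  have hF' : surfF (FChat f ν h) p = 0 := by
    rw [surfF, wu, wv, real_inner_smul_right, ho1 p hp, mul_zero]
  have hG' : surfG (FChat f ν h) p = r p ^ 2 := by
    rw [surfG, wv, norm_smul, hν1 p hp, mul_one, Real.norm_eq_abs, sq_abs]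
  rw [gaussK, hL', hM', hN', hE', hF', hG', hD, hE, Real.sqrt_sq hs0.le, ← he, hrp,
    div_pow (2 * _ * _), mul_pow, mul_pow, sq_rpow_three_quarters_sq he0.le,
    sq_rpow_three_quarters_sq hs0.le]
  field_simp
  ring
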